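/- arXiv:math/0410311 — 3 statements merged into one kernel-verified Lean document; each statement's English description precedes it below -/
import Mathlib

section
/- Let p∈[0,1) and let G satisfy G(0)=0 and 1<G'(1)<∞. The equation α=f_p(α) has a root at α=1; it has either one or two roots in the interval [pθ,1]; and it has two distinct roots in this interval if and only if G'(1−pθ)>1. -/
open scoped BigOperators

theorem pow_add_mul_sub_lt_pow {x y : ℝ} (hx : 0 ≤ x) (hy : 0 ≤ y) (hxy : x ≠ y) (n : ℕ) :
    y ^ (n + 2) + (n + 2) * y ^ (n + 1) * (x - y) < x ^ (n + 2) := by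
  rcases hy.eq_or_lt with rfl | hy
  · simpa using pow_pos (hx.lt_of_ne' hxy) (n + 2)
  have hsq : 0 < (x - y) ^ 2 := by have := sub_ne_zero.2 hxy; positivity
  induction n with
  | zero => norm_num; nlinarith
  | succ n ih =>
    have h := mul_le_mul_of_nonneg_left ih.le hx
    have h2 : 0 < (n + 2) * y ^ (n + 1) * (x - y) ^ 2 := by positivity
    push_cast
    ring_nf at h h2 ⊢
    linarith

theorem pow_add_mul_sub_le_pow {x y : ℝ} (hx : 0 ≤ x) (hy : 0 ≤ y) (k : ℕ) :
    y ^ k + k * y ^ (k - 1) * (x - y) ≤ x ^ k := by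
  rcases eq_or_ne x y with rfl | hxy
  · simp
  match k with
  | 0 => simp
  | 1 => simp
  | n + 2 => simpa using (pow_add_mul_sub_lt_pow hx hy hxy n).le

section PowerSeries

variable {a : ℕ → ℝ}

theorem summable_mul_pow_of_mem_Icc (hpos : ∀ k, 0 ≤ a k) (hs : Summable a) {x : ℝ}
    (hx : x ∈ Set.Icc (0 : ℝ) 1) (e : ℕ → ℕ) : Summable fun k => a k * x ^ e k :=
  hs.of_nonneg_of_le (fun k => mul_nonneg (hpos k) (pow_nonneg hx.1 _))
    fun k => mul_le_of_le_one_right (hpos k) (pow_le_one₀ hx.1 hx.2)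

theorem continuousOn_tsum_mul_pow (hpos : ∀ k, 0 ≤ a k) (hs : Summable a) (e : ℕ → ℕ) :
    ContinuousOn (fun x : ℝ => ∑' k, a k * x ^ e k) (Set.Icc 0 1) := by
  refine continuousOn_tsum (fun k => by fun_prop) hs fun k x hx => ?_
  rw [Real.norm_of_nonneg (mul_nonneg (hpos k) (pow_nonneg hx.1 _))]
  exact mul_le_of_le_one_right (hpos k) (pow_le_one₀ hx.1 hx.2)

/-- A probability distribution on the positive integers with mean above one charges some `k ≥ 2`. -/
theorem exists_pos_of_one_lt_mean (hpos : ∀ k, 0 ≤ a k) (hs : Summable a) (ht : ∑' k, a k = 1)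
    (hmean : 1 < ∑' k : ℕ, (k : ℝ) * a k) : ∃ n, 0 < a (n + 2) := by
  by_contra! h
  have hz : ∀ n, a (n + 2) = 0 := fun n => le_antisymm (h n) (hpos _)
  have h1 : ∑' k : ℕ, (k : ℝ) * a k = a 1 := by
    rw [tsum_eq_single 1]
    · simp
    · intro k hk
      match k with
      | 0 => simp
      | 1 => exact absurd rfl hk
      | n + 2 => simp [hz]
  have := hs.le_tsum 1 fun k _ => hpos k
  linarith

/-- The generating function lies strictly above each of its tangents. -/
theorem tsum_tangent_lt (hpos : ∀ k, 0 ≤ a k) (hs : Summable a)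
    (hms : Summable fun k : ℕ => (k : ℝ) * a k) (hn : ∃ n, 0 < a (n + 2)) {x y : ℝ}
    (hx : x ∈ Set.Icc (0 : ℝ) 1) (hy : y ∈ Set.Icc (0 : ℝ) 1) (hxy : x ≠ y) :
    (∑' k, a k * y ^ k) + (∑' k : ℕ, (k : ℝ) * a k * y ^ (k - 1)) * (x - y) <
      ∑' k, a k * x ^ k := by
  obtain ⟨n, hn⟩ := hn
  have hGy := summable_mul_pow_of_mem_Icc hpos hs hy id
  have hGx := summable_mul_pow_of_mem_Icc hpos hs hx id
  have hDy := (summable_mul_pow_of_mem_Icc (fun k => mul_nonneg k.cast_nonneg (hpos k)) hms hy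
    (· - 1)).mul_right (x - y)
  simp only [id] at hGy hGx
  rw [← tsum_mul_right, ← hGy.tsum_add hDy]
  refine Summable.tsum_lt_tsum (i := n + 2) (fun k => ?_) ?_ (hGy.add hDy) hGx
  · have := mul_le_mul_of_nonneg_left (pow_add_mul_sub_le_pow hx.1 hy.1 k) (hpos k)
    linarith
  · have := mul_lt_mul_of_pos_left (pow_add_mul_sub_lt_pow hx.1 hy.1 hxy n) hn
    push_cast
    linarith

end PowerSeries

/-- A function on `[0, 1]` lying strictly above its tangents takes the values of a line of slope one
at most twice. -/
theorem not_three_of_tangent_lt {G G' : ℝ → ℝ} {x y z d : ℝ}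
    (htan : ∀ x ∈ Set.Icc (0 : ℝ) 1, ∀ y ∈ Set.Icc (0 : ℝ) 1, x ≠ y →
      G y + G' y * (x - y) < G x)
    (hx : 0 ≤ x) (hxy : x < y) (hyz : y < z) (hz : z ≤ 1)
    (hGx : G x = x + d) (hGy : G y = y + d) (hGz : G z = z + d) : False := by
  have h1 := htan x ⟨hx, by linarith⟩ y ⟨by linarith, by linarith⟩ hxy.ne
  have h2 := htan z ⟨by linarith, hz⟩ y ⟨by linarith, by linarith⟩ hyz.ne'
  have h3 : 1 < G' y := by nlinarith
  nlinarith

theorem exists_eq_add_of_one_lt_deriv {G G' : ℝ → ℝ} {c d : ℝ}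
    (hG : ContinuousOn G (Set.Icc 0 1)) (hG' : ContinuousOn G' (Set.Icc 0 1))
    (htan : ∀ x ∈ Set.Icc (0 : ℝ) 1, ∀ y ∈ Set.Icc (0 : ℝ) 1, x ≠ y →
      G y + G' y * (x - y) < G x)
    (hc : c ∈ Set.Ioc (0 : ℝ) 1) (h0 : d ≤ G 0) (hGc : G c = c + d) (hd : 1 < G' c) :
    ∃ x ∈ Set.Ico 0 c, G x = x + d := by
  have hcont : ContinuousWithinAt G' (Set.Ioo 0 c) c :=
    (hG' c ⟨hc.1.le, hc.2⟩).mono fun x hx => ⟨hx.1.le, hx.2.le.trans hc.2⟩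
  have hev := hcont.eventually (lt_mem_nhds hd)
  rw [nhdsWithin_Ioo_eq_nhdsLT hc.1] at hev
  obtain ⟨y, hy, hy0, hyc⟩ := (hev.and (Ioo_mem_nhdsLT hc.1)).exists
  have h1 := htan c ⟨hc.1.le, hc.2⟩ y ⟨hy0.le, hyc.le.trans hc.2⟩ hyc.ne'
  have hGy : G y - y < d := by nlinarith
  have hsub : ContinuousOn (fun x => G x - x) (Set.Icc 0 y) :=
    (hG.mono (Set.Icc_subset_Icc_right (hyc.le.trans hc.2))).sub continuousOn_id
  obtain ⟨x, hx, hxd⟩ := intermediate_value_Icc' hy0.le hsub ⟨hGy.le, by simpa using h0⟩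
  exact ⟨x, ⟨hx.1, hx.2.trans_lt hyc⟩, by simp only at hxd; linarith⟩

/-- Let `(a k)_{k≥1}` be a probability distribution on the positive
integers with probability generating function `G(x) = ∑_{k≥1} a k x^k` (so `G(0) = 0`)
and mean `G'(1) = ∑ k * a k ∈ (1, ∞)`. Let `p ∈ [0,1)`, let `θ` be the largest root in
`[0,1]` of `θ = 1 - G(1 - pθ)`, and let `f = f_p` be given by `f(α) = θ + G(α - pθ)` on
`[pθ, 1]`. Then the equation `α = f(α)` has a root at `α = 1`; it has either one or two
roots in `[pθ, 1]`; and it has two distinct roots there if and only if `G'(1 - pθ) > 1`. -/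
theorem fixed_points_of_f (a : ℕ → ℝ) (hpos : ∀ k, 0 ≤ a k) (hsummable : Summable a)
    (htotal : ∑' k, a k = 1) (hzero : a 0 = 0)
    (hmean_summable : Summable fun k : ℕ => (k : ℝ) * a k)
    (hmean : 1 < ∑' k : ℕ, (k : ℝ) * a k)
    (G : ℝ → ℝ) (hG : ∀ x, G x = ∑' k, a k * x ^ k)
    (G' : ℝ → ℝ) (hG' : ∀ x, G' x = ∑' k : ℕ, (k : ℝ) * a k * x ^ (k - 1))
    (p : ℝ) (hp : p ∈ Set.Ico (0 : ℝ) 1)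
    (θ : ℝ) (hθ : IsGreatest {t | t ∈ Set.Icc (0 : ℝ) 1 ∧ t = 1 - G (1 - p * t)} θ)
    (f : ℝ → ℝ) (hf : ∀ α, f α = θ + G (α - p * θ)) :
    f 1 = 1 ∧
    ({α | α ∈ Set.Icc (p * θ) 1 ∧ f α = α}.ncard = 1 ∨
      {α | α ∈ Set.Icc (p * θ) 1 ∧ f α = α}.ncard = 2) ∧
    ({α | α ∈ Set.Icc (p * θ) 1 ∧ f α = α}.ncard = 2 ↔ 1 < G' (1 - p * θ)) := by
  obtain ⟨⟨⟨hθ0, hθ1⟩, hθeq⟩, -⟩ := hθ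
  obtain ⟨hp0, hp1⟩ := hp
  have hpθ0 : 0 ≤ p * θ := mul_nonneg hp0 hθ0
  have hpθ1 : p * θ < 1 := by nlinarith
  have hpθ : p * θ ≤ θ := mul_le_of_le_one_left hθ0 hp1.le
  have hn := exists_pos_of_one_lt_mean hpos hsummable htotal hmean
  have htan : ∀ x ∈ Set.Icc (0 : ℝ) 1, ∀ y ∈ Set.Icc (0 : ℝ) 1, x ≠ y →
      G y + G' y * (x - y) < G x := by
    intro x hx y hy hxy
    rw [hG, hG, hG']
    exact tsum_tangent_lt hpos hsummable hmean_summable hn hx hy hxy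
  have hGcont : ContinuousOn G (Set.Icc 0 1) := by
    rw [funext hG]
    exact continuousOn_tsum_mul_pow hpos hsummable id
  have hG'cont : ContinuousOn G' (Set.Icc 0 1) := by
    rw [funext hG']
    exact continuousOn_tsum_mul_pow (fun k => mul_nonneg k.cast_nonneg (hpos k))
      hmean_summable (· - 1)
  have hG0 : G 0 = 0 := by
    rw [hG, tsum_eq_single 0 fun k hk => by simp [hk]]
    simp [hzero]
  have hf1 : f 1 = 1 := by rw [hf]; linarith
  have hGroot : ∀ {α}, f α = α → G (α - p * θ) = (α - p * θ) + (p * θ - θ) := by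
    intro α h
    rw [hf] at h
    linarith
  have hone : 1 < G' (1 - p * θ) ↔ ∃ α ∈ Set.Ico (p * θ) 1, f α = α := by
    constructor
    · intro h
      obtain ⟨x, hx, hGx⟩ := exists_eq_add_of_one_lt_deriv hGcont hG'cont htan
        ⟨by linarith, by linarith⟩ (by linarith) (hGroot hf1) h
      refine ⟨x + p * θ, ⟨by linarith [hx.1], by linarith [hx.2]⟩, ?_⟩
      rw [hf, add_sub_cancel_right]
      linarith
    · rintro ⟨α, hα, hfα⟩
      have h := htan (α - p * θ) ⟨by linarith [hα.1], by linarith [hα.2]⟩ (1 - p * θ)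
        ⟨by linarith, by linarith⟩ (by linarith [hα.2])
      have h1 := hGroot hfα
      have h2 := hGroot hf1
      nlinarith [hα.2]
  have htwo : 1 < G' (1 - p * θ) → {α | α ∈ Set.Icc (p * θ) 1 ∧ f α = α}.ncard = 2 := by
    intro h
    obtain ⟨α, hα, hfα⟩ := hone.1 h
    rw [Set.ncard_eq_two]
    refine ⟨α, 1, hα.2.ne, Set.ext fun β => ⟨?_, ?_⟩⟩
    · rintro ⟨hβ, hfβ⟩
      by_contra hne
      simp only [Set.mem_insert_iff, Set.mem_singleton_iff, not_or] at hne
      have hβ1 := hβ.2.lt_of_ne hne.2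
      rcases lt_or_gt_of_ne hne.1 with hlt | hlt
      · exact not_three_of_tangent_lt htan (sub_nonneg.2 hβ.1) (sub_lt_sub_right hlt _)
          (sub_lt_sub_right hα.2 _) (by linarith) (hGroot hfβ) (hGroot hfα) (hGroot hf1)
      · exact not_three_of_tangent_lt htan (sub_nonneg.2 hα.1) (sub_lt_sub_right hlt _)
          (sub_lt_sub_right hβ1 _) (by linarith) (hGroot hfα) (hGroot hfβ) (hGroot hf1)
    · rintro (rfl | rfl)
      · exact ⟨⟨hα.1, hα.2.le⟩, hfα⟩
      · exact ⟨⟨hpθ1.le, le_rfl⟩, hf1⟩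
  have hsingle : ¬ 1 < G' (1 - p * θ) → {α | α ∈ Set.Icc (p * θ) 1 ∧ f α = α}.ncard = 1 := by
    intro h
    rw [Set.ncard_eq_one]
    refine ⟨1, Set.ext fun β => ⟨?_, ?_⟩⟩
    · rintro ⟨hβ, hfβ⟩
      by_contra hne
      exact h (hone.2 ⟨β, ⟨hβ.1, hβ.2.lt_of_ne hne⟩, hfβ⟩)
    · rintro rfl
      exact ⟨⟨hpθ1.le, le_rfl⟩, hf1⟩
  refine ⟨hf1, ?_, ?_⟩
  · by_cases h : 1 < G' (1 - p * θ)
    · exact Or.inr (htwo h)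
    · exact Or.inl (hsingle h)
  · refine ⟨fun h => ?_, htwo⟩
    by_contra hlt
    have := hsingle hlt
    omega
end

section
/- Consider a branching process whose family-size probability generating function G satisfies G(0)=0 and 1<G'(1)<∞, and let p∈[0,1). Then γ, the probability that the root is black, is the smallest root in the interval [pθ,1] of the equation γ = θ + G(γ−pθ). -/
open MeasureTheory
open scoped ENNReal

namespace GW

/-- A point of the sample space: for each finite word `w` (a potential vertex of the
family-tree), the pair consisting of the number of children of `w` and the state
(open = `true`) of the edge leading into `w`. -/
abbrev Cfg := List ℕ → ℕ × Bool

/-- The word formed by the first `n` values of the sequence `s`. -/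
def prefixSeq (s : ℕ → ℕ) (n : ℕ) : List ℕ := List.ofFn fun i : Fin n => s i

/-- The word `w` is a vertex of the family-tree determined by `ω`: each letter of `w` is
smaller than the offspring number of the corresponding prefix. -/
def InTree (ω : Cfg) (w : List ℕ) : Prop :=
  ∀ i : Fin w.length, w.get i < (ω (w.take i)).1

/-- The vertex `v` is blue: some infinite directed path of the tree starting at `v`
consists entirely of open edges. -/
def BlueAt (ω : Cfg) (v : List ℕ) : Prop :=
  ∃ s : ℕ → ℕ, ∀ n : ℕ,
    InTree ω (v ++ prefixSeq s (n + 1)) ∧ (ω (v ++ prefixSeq s (n + 1))).2 = true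

/-- The root is black: every infinite directed path of the tree starting at the root
contains a blue vertex. -/
def BlackRoot (ω : Cfg) : Prop :=
  ∀ s : ℕ → ℕ, (∀ n, InTree ω (prefixSeq s n)) → ∃ n, BlueAt ω (prefixSeq s n)

/-- `P` is the law of a Galton–Watson tree with offspring distribution `a` together with
independent bond percolation with density `p`: the coordinates are i.i.d., with offspring
numbers distributed according to `a` independent of edge states which are Bernoulli(`p`). -/
def IsGWPerc (a : ℕ → ℝ) (p : ℝ) (P : Measure Cfg) : Prop :=
  IsProbabilityMeasure P ∧
    ∀ (s : Finset (List ℕ)) (g : List ℕ → ℕ × Bool),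
      P {ω | ∀ w ∈ s, ω w = g w} =
        ∏ w ∈ s,
          (ENNReal.ofReal (a (g w).1) * ENNReal.ofReal (if (g w).2 then p else 1 - p))

open ProbabilityTheory

/-! ### Subtrees and recursive descriptions of blue and black -/

/-- The configuration seen from the child `i` of the root. -/
def sub (ω : Cfg) (i : ℕ) : Cfg := fun v => ω (i :: v)

lemma prefixSeq_succ (s : ℕ → ℕ) (n : ℕ) :
    prefixSeq s (n + 1) = s 0 :: prefixSeq (fun m => s (m + 1)) n := by
  simp [prefixSeq, List.ofFn_succ]

lemma inTree_nil (ω : Cfg) : InTree ω [] := fun i => i.elim0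

lemma inTree_cons (ω : Cfg) (i : ℕ) (w : List ℕ) :
    InTree ω (i :: w) ↔ i < (ω []).1 ∧ InTree (sub ω i) w := by
  simp only [InTree, sub]
  exact Fin.forall_fin_succ

lemma blueAt_cons (ω : Cfg) (i : ℕ) (v : List ℕ) :
    BlueAt ω (i :: v) ↔ i < (ω []).1 ∧ BlueAt (sub ω i) v := by
  simp only [BlueAt, List.cons_append, inTree_cons]
  constructor
  · rintro ⟨s, hs⟩
    exact ⟨(hs 0).1.1, s, fun n => ⟨(hs n).1.2, (hs n).2⟩⟩
  · rintro ⟨hi, s, hs⟩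
    exact ⟨s, fun n => ⟨⟨hi, (hs n).1⟩, (hs n).2⟩⟩

lemma blueAt_nil_iff (ω : Cfg) :
    BlueAt ω [] ↔ ∃ i < (ω []).1, (sub ω i []).2 = true ∧ BlueAt (sub ω i) [] := by
  simp only [BlueAt, List.nil_append]
  constructor
  · rintro ⟨s, hs⟩
    simp only [prefixSeq_succ s, inTree_cons] at hs
    exact ⟨s 0, (hs 0).1.1, (hs 0).2, fun m => s (m + 1),
      fun n => ⟨(hs (n + 1)).1.2, (hs (n + 1)).2⟩⟩
  · rintro ⟨i, hi, ho, s, hs⟩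
    refine ⟨fun n => Nat.casesOn n i s, fun n => ?_⟩
    simp only [prefixSeq_succ _ n, inTree_cons]
    cases n with
    | zero => exact ⟨⟨hi, inTree_nil _⟩, ho⟩
    | succ n => exact ⟨⟨hi, (hs n).1⟩, (hs n).2⟩

lemma blackRoot_iff (ω : Cfg) :
    BlackRoot ω ↔ BlueAt ω [] ∨ ∀ i < (ω []).1, BlackRoot (sub ω i) := by
  constructor
  · intro h
    refine or_iff_not_imp_left.2 fun hb i hi s hs => ?_
    obtain ⟨n, hn⟩ := h (fun n => Nat.casesOn n i s) fun n => by
      cases n with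
      | zero => exact inTree_nil _
      | succ n =>
        rw [prefixSeq_succ, inTree_cons]
        exact ⟨hi, hs n⟩
    cases n with
    | zero => exact absurd hn hb
    | succ n =>
      rw [prefixSeq_succ, blueAt_cons] at hn
      exact ⟨n, hn.2⟩
  · rintro (h | h) s hs
    · exact ⟨0, h⟩
    · have hs' := fun n => (inTree_cons _ _ _).1 (prefixSeq_succ s n ▸ hs (n + 1))
      obtain ⟨n, hn⟩ := h (s 0) (hs' 0).1 _ fun n => (hs' n).2
      refine ⟨n + 1, ?_⟩
      rw [prefixSeq_succ, blueAt_cons]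
      exact ⟨(hs' 0).1, hn⟩

/-! ### Compactness -/

/-- The configuration seen from the `n`-th vertex of the path obtained by iterating the choice
function `f`. -/
def follow (f : Cfg → ℕ) (ω : Cfg) : ℕ → Cfg
  | 0 => ω
  | n + 1 => follow f (sub ω (f ω)) n

/-- If every configuration satisfying `Q` has a child satisfying `Q` and joined to the root by
an edge satisfying `R`, then `Q` and `R` hold along some infinite path. -/
lemma exists_path {Q : Cfg → Prop} {R : Cfg → Prop}
    (h : ∀ ω, Q ω → ∃ i < (ω []).1, R (sub ω i) ∧ Q (sub ω i)) {ω : Cfg} (hω : Q ω) :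
    ∃ s : ℕ → ℕ, ∀ n, InTree ω (prefixSeq s n) ∧ Q (fun v => ω (prefixSeq s n ++ v)) ∧
      R (fun v => ω (prefixSeq s (n + 1) ++ v)) := by
  choose! f hf hR hQ using h
  refine ⟨fun n => f (follow f ω n), fun n => ?_⟩
  induction n generalizing ω with
  | zero =>
    refine ⟨inTree_nil _, hω, hR ω hω⟩
  | succ n ih =>
    obtain ⟨h1, h2, h3⟩ := ih (hQ ω hω)
    rw [prefixSeq_succ _ (n + 1), prefixSeq_succ _ n, inTree_cons]
    exact ⟨⟨hf ω hω, h1⟩, h2, h3⟩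

lemma exists_lt_forall_of_antitone {k : ℕ} {S : ℕ → ℕ → Prop}
    (hS : ∀ i m n, m ≤ n → S n i → S m i) (h : ∀ n, ∃ i < k, S n i) :
    ∃ i < k, ∀ n, S n i := by
  by_contra! hc
  choose! N hN using hc
  obtain ⟨i, hi, hSi⟩ := h ((Finset.range k).sup N)
  exact hN i hi (hS i _ _ (Finset.le_sup (Finset.mem_range.2 hi)) hSi)

/-- The event that the root is blue. -/
def blue : Set Cfg := {ω | BlueAt ω []}

/-- The event that the edge leading into the root is open. -/
def rootOpen : Set Cfg := {ω | (ω []).2 = true}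

/-- The event that all subtrees at the children of the root belong to `A`. -/
def allSub (A : Set Cfg) : Set Cfg := {ω | ∀ i < (ω []).1, sub ω i ∈ A}

lemma allSub_mono {A B : Set Cfg} (h : A ⊆ B) : allSub A ⊆ allSub B :=
  fun _ hω i hi => h (hω i hi)

lemma allSub_inter (A B : Set Cfg) : allSub (A ∩ B) = allSub A ∩ allSub B := by
  ext ω
  exact ⟨fun h => ⟨fun i hi => (h i hi).1, fun i hi => (h i hi).2⟩,
    fun h i hi => ⟨h.1 i hi, h.2 i hi⟩⟩

lemma blue_compl : blueᶜ = allSub (rootOpen ∩ blue)ᶜ := by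
  ext ω
  simp [blue, allSub, rootOpen, blueAt_nil_iff ω]

/-- The event that an open path of length `n` starts at the root. -/
def blueN : ℕ → Set Cfg
  | 0 => Set.univ
  | n + 1 => (allSub (rootOpen ∩ blueN n)ᶜ)ᶜ

lemma blueN_antitone : Antitone blueN := by
  refine antitone_nat_of_succ_le fun n => ?_
  induction n with
  | zero => exact Set.subset_univ _
  | succ n ih =>
    exact Set.compl_subset_compl.2 (allSub_mono (Set.compl_subset_compl.2
      (Set.inter_subset_inter_right _ ih)))

lemma mem_blueN_succ {n : ℕ} {ω : Cfg} :
    ω ∈ blueN (n + 1) ↔ ∃ i < (ω []).1, sub ω i ∈ rootOpen ∩ blueN n := by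
  simp [blueN, allSub]

lemma blue_eq_iInter : blue = ⋂ n, blueN n := by
  refine Set.Subset.antisymm (Set.subset_iInter fun n => ?_) fun ω hω => ?_
  · induction n with
    | zero => exact Set.subset_univ _
    | succ n ih =>
      refine Set.compl_subset_compl.1 ?_
      rw [blue_compl, blueN, compl_compl]
      exact allSub_mono (Set.compl_subset_compl.2 (Set.inter_subset_inter_right _ ih))
  · obtain ⟨s, hs⟩ := exists_path (Q := fun ω => ∀ n, ω ∈ blueN n) (R := (· ∈ rootOpen))
      (fun ω hω => by
        obtain ⟨i, hi, h⟩ := exists_lt_forall_of_antitone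
          (S := fun n i => sub ω i ∈ rootOpen ∩ blueN n)
          (fun i m n hmn h => ⟨h.1, blueN_antitone hmn h.2⟩)
          (fun n => mem_blueN_succ.1 (hω (n + 1)))
        exact ⟨i, hi, (h 0).1, fun n => (h n).2⟩) (Set.mem_iInter.1 hω)
    refine ⟨s, fun n => ⟨(hs (n + 1)).1, ?_⟩⟩
    simpa [rootOpen] using (hs n).2.2

/-- The event that the root is blue or all subtrees at its children belong to `C`. -/
def step (C : Set Cfg) : Set Cfg := blue ∪ allSub C

lemma step_mono {C D : Set Cfg} (h : C ⊆ D) : step C ⊆ step D :=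
  Set.union_subset_union_right _ (allSub_mono h)

/-- The event that every path of length `n` from the root contains a blue vertex. -/
def blackN : ℕ → Set Cfg
  | 0 => blue
  | n + 1 => step (blackN n)

lemma blackN_monotone : Monotone blackN := by
  refine monotone_nat_of_le_succ fun n => ?_
  induction n with
  | zero => exact Set.subset_union_left
  | succ n ih => exact step_mono ih

lemma step_black : step {ω | BlackRoot ω} = {ω | BlackRoot ω} := by
  ext ω
  exact (blackRoot_iff ω).symm

lemma black_eq_iUnion : {ω | BlackRoot ω} = ⋃ n, blackN n := by
  refine Set.Subset.antisymm (fun ω hω => ?_) (Set.iUnion_subset fun n => ?_)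
  · by_contra hc
    obtain ⟨s, hs⟩ := exists_path (Q := fun ω => ∀ n, ω ∉ blackN n) (R := fun _ => True)
      (fun ω hω => by
        obtain ⟨i, hi, h⟩ := exists_lt_forall_of_antitone
          (S := fun n i => sub ω i ∉ blackN n) (k := (ω []).1)
          (fun i m n hmn h h' => h (blackN_monotone hmn h'))
          (fun n => by
            have := hω (n + 1)
            simp only [blackN, step, allSub, Set.mem_union, not_or, Set.mem_ofPred_eq] at this
            push Not at this
            exact this.2)
        exact ⟨i, hi, trivial, h⟩) (by simpa using hc)
    obtain ⟨n, hn⟩ := hω s fun n => (hs n).1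
    refine (hs n).2.1 0 ?_
    have key : ∀ (v : List ℕ) (ω : Cfg), BlueAt ω v → BlueAt (fun u => ω (v ++ u)) [] := by
      intro v
      induction v with
      | nil => exact fun ω h => h
      | cons i v ih => exact fun ω h => ih (sub ω i) ((blueAt_cons _ _ _).1 h).2
    exact key _ _ hn
  · induction n with
    | zero => exact fun ω h => (blackRoot_iff ω).2 (Or.inl h)
    | succ n ih =>
      rw [← step_black]
      exact step_mono ih

/-! ### Measurability -/

lemma measurable_sub (i : ℕ) : Measurable fun ω : Cfg => sub ω i :=
  measurable_pi_iff.2 fun v => measurable_pi_apply (i :: v)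

lemma measurableSet_allSub {A : Set Cfg} (hA : MeasurableSet A) : MeasurableSet (allSub A) := by
  have : allSub A = ⋂ i : ℕ, {ω : Cfg | i < (ω []).1}ᶜ ∪ (fun ω => sub ω i) ⁻¹' A := by
    ext ω
    simp only [allSub, Set.mem_ofPred_eq, Set.mem_iInter, Set.mem_union, Set.mem_compl_iff,
      Set.mem_preimage, ← imp_iff_not_or]
  rw [this]
  refine MeasurableSet.iInter fun i => MeasurableSet.union ?_ (measurable_sub i hA)
  exact (measurableSet_lt measurable_const (measurable_fst.comp (measurable_pi_apply []))).compl

lemma measurableSet_root (S : Set (ℕ × Bool)) : MeasurableSet {ω : Cfg | ω [] ∈ S} :=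
  measurable_pi_apply (X := fun _ : List ℕ => ℕ × Bool) [] (MeasurableSet.of_discrete (s := S))

lemma measurableSet_rootOpen : MeasurableSet rootOpen := measurableSet_root {x | x.2 = true}

lemma measurableSet_blue : MeasurableSet blue := by
  rw [blue_eq_iInter]
  refine MeasurableSet.iInter fun n => ?_
  induction n with
  | zero => exact MeasurableSet.univ
  | succ n ih => exact (measurableSet_allSub (measurableSet_rootOpen.inter ih).compl).compl

lemma measurableSet_blackN (n : ℕ) : MeasurableSet (blackN n) := by
  induction n with
  | zero => exact measurableSet_blue
  | succ n ih => exact measurableSet_blue.union (measurableSet_allSub ih)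

/-! ### The branching property -/

section Branching

variable {a : ℕ → ℝ} {p : ℝ} {P : Measure Cfg}

lemma IsGWPerc.measure_root (hP : IsGWPerc a p P) (w : List ℕ) (x : ℕ × Bool) :
    P {ω | ω w = x} = ENNReal.ofReal (a x.1) * ENNReal.ofReal (if x.2 then p else 1 - p) := by
  simpa using hP.2 {w} fun _ => x

lemma IsGWPerc.eq_infinitePi (hP : IsGWPerc a p P) :
    P = Measure.infinitePi fun _ : List ℕ => P.map fun ω => ω [] := by
  have := hP.1
  have : IsProbabilityMeasure (P.map fun ω : Cfg => ω []) :=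
    Measure.isProbabilityMeasure_map (measurable_pi_apply []).aemeasurable
  refine IsProjectiveLimit.unique (fun s => ?_) (Measure.isProjectiveLimit_infinitePi _)
  refine Measure.ext_of_singleton fun g => ?_
  rw [Measure.pi_singleton, Measure.map_apply (Finset.measurable_restrict s)
    (measurableSet_singleton g)]
  let g' : List ℕ → ℕ × Bool := fun w => if h : w ∈ s then g ⟨w, h⟩ else (0, true)
  have hset : (s.restrict (π := fun _ => ℕ × Bool)) ⁻¹' {g} = {ω : Cfg | ∀ w ∈ s, ω w = g' w} := by
    ext ω
    simp only [Set.mem_preimage, Set.mem_singleton_iff, Set.mem_ofPred_eq, funext_iff,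
      Subtype.forall, Finset.restrict]
    refine forall₂_congr fun w hw => ?_
    simp [g', hw]
  rw [hset, hP.2, ← Finset.prod_coe_sort]
  refine Finset.prod_congr rfl fun w _ => ?_
  rw [Measure.map_apply (measurable_pi_apply []) (measurableSet_singleton _)]
  simp only [g', w.2, dite_true]
  exact (hP.measure_root [] (g w)).symm

lemma IsGWPerc.map_sub (hP : IsGWPerc a p P) :
    P.map (fun ω i => sub ω i) = Measure.infinitePi fun _ : ℕ => P := by
  have := hP.1
  set ν := P.map fun ω : Cfg => ω [] with hν
  have : IsProbabilityMeasure ν :=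
    Measure.isProbabilityMeasure_map (measurable_pi_apply []).aemeasurable
  have hPν : P = Measure.infinitePi fun _ : List ℕ => ν := hP.eq_infinitePi
  have hinj : Function.Injective fun q : ℕ × List ℕ => q.1 :: q.2 := by
    rintro ⟨i, v⟩ ⟨j, w⟩ h
    simpa using h
  have h1 := Measure.map_infinitePi_infinitePi_of_inj (P := fun _ : List ℕ => ν) hinj
  have h2 := Measure.infinitePi_map_curry (fun (_ : ℕ) (_ : List ℕ) => ν)
  rw [← h1, Measure.map_map (MeasurableEquiv.measurable _) (by fun_prop), ← hPν] at h2
  exact h2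

lemma IsGWPerc.indepFun (hP : IsGWPerc a p P) :
    IndepFun (fun ω : Cfg => ω []) (fun ω i => sub ω i) P := by
  have := hP.1
  set ν := P.map fun ω : Cfg => ω [] with hν
  have : IsProbabilityMeasure ν :=
    Measure.isProbabilityMeasure_map (measurable_pi_apply []).aemeasurable
  have hPν : P = Measure.infinitePi fun _ : List ℕ => ν := hP.eq_infinitePi
  have hi : iIndepFun (fun (w : List ℕ) (ω : Cfg) => ω w) P := by
    rw [hPν]
    exact iIndepFun_infinitePi (X := fun (_ : List ℕ) (x : ℕ × Bool) => x)
      fun _ => measurable_id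
  have hd := indep_iSup_of_disjoint (S := {[]}) (T := {[]}ᶜ)
    (fun w => (measurable_pi_apply w).comap_le) hi.iIndep disjoint_compl_right
  rw [IndepFun_iff_Indep]
  refine indep_of_indep_of_le_left (indep_of_indep_of_le_right hd ?_) ?_
  · refine Measurable.comap_le ?_
    refine @measurable_pi_lambda _ _ _ (_) _ _ fun i => ?_
    refine @measurable_pi_lambda _ _ _ (_) _ _ fun v => ?_
    refine Measurable.mono (comap_measurable fun ω : Cfg => ω (i :: v)) ?_ le_rfl
    exact le_iSup₂_of_le (i :: v) (by simp) le_rfl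
  · exact le_iSup₂_of_le [] rfl le_rfl

lemma IsGWPerc.measure_root_inter_allSub (hP : IsGWPerc a p P) {A : Set Cfg}
    (hA : MeasurableSet A) (x : ℕ × Bool) :
    P ({ω | ω [] = x} ∩ allSub A) = P {ω | ω [] = x} * P A ^ x.1 := by
  have := hP.1
  have hset : {ω : Cfg | ω [] = x} ∩ allSub A = (fun ω : Cfg => ω []) ⁻¹' {x} ∩
      (fun ω i => sub ω i) ⁻¹' (Set.pi (Finset.range x.1) fun _ => A) := by
    ext ω
    simp only [allSub, Set.mem_inter_iff, Set.mem_ofPred_eq, Set.mem_preimage,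
      Set.mem_singleton_iff, Set.mem_pi, Finset.coe_range, Set.mem_Iio]
    refine and_congr_right fun h => ?_
    rw [h]
  have hm : MeasurableSet (Set.pi (Finset.range x.1 : Set ℕ) fun _ => A) :=
    MeasurableSet.pi (Finset.countable_toSet _) fun _ _ => hA
  rw [hset, hP.indepFun.measure_inter_preimage_eq_mul _ _ (measurableSet_singleton x) hm,
    ← Measure.map_apply (measurable_pi_iff.2 measurable_sub) hm, hP.map_sub,
    Measure.infinitePi_pi _ fun _ _ => hA]
  simp [Set.preimage]

lemma IsGWPerc.measureReal_root_snd_inter_allSub (hP : IsGWPerc a p P) (hpos : ∀ k, 0 ≤ a k)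
    (hp : p ∈ Set.Ico (0 : ℝ) 1) {A : Set Cfg} (hA : MeasurableSet A) (b : Bool) :
    P.real ({ω | (ω []).2 = b} ∩ allSub A) =
      (if b then p else 1 - p) * ∑' k, a k * P.real A ^ k := by
  have := hP.1
  have hb : 0 ≤ if b then p else 1 - p := by
    split_ifs
    · exact hp.1
    · linarith [hp.2]
  have hset : {ω : Cfg | (ω []).2 = b} ∩ allSub A =
      ⋃ k : ℕ, {ω : Cfg | ω [] = (k, b)} ∩ allSub A := by
    ext ω
    simp [Prod.ext_iff]
  have hd : Pairwise (Function.onFun Disjoint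
      fun k : ℕ => {ω : Cfg | ω [] = (k, b)} ∩ allSub A) := by
    intro k l hkl
    refine Set.disjoint_left.2 fun ω h h' => hkl ?_
    exact congrArg Prod.fst (h.1.symm.trans h'.1)
  rw [measureReal_def, hset, measure_iUnion hd fun k =>
    (measurableSet_root {(k, b)}).inter (measurableSet_allSub hA),
    ENNReal.tsum_toReal_eq fun k => measure_ne_top _ _, ← tsum_mul_left]
  refine tsum_congr fun k => ?_
  rw [hP.measure_root_inter_allSub hA, hP.measure_root]
  simp only [ENNReal.toReal_mul, ENNReal.toReal_pow, ENNReal.toReal_ofReal (hpos k),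
    ENNReal.toReal_ofReal hb, ← measureReal_def]
  ring

lemma IsGWPerc.measureReal_rootOpen_inter_allSub (hP : IsGWPerc a p P) (hpos : ∀ k, 0 ≤ a k)
    (hp : p ∈ Set.Ico (0 : ℝ) 1) {A : Set Cfg} (hA : MeasurableSet A) :
    P.real (rootOpen ∩ allSub A) = p * ∑' k, a k * P.real A ^ k := by
  exact hP.measureReal_root_snd_inter_allSub hpos hp hA true

lemma IsGWPerc.measureReal_allSub (hP : IsGWPerc a p P) (hpos : ∀ k, 0 ≤ a k)
    (hp : p ∈ Set.Ico (0 : ℝ) 1) {A : Set Cfg} (hA : MeasurableSet A) :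
    P.real (allSub A) = ∑' k, a k * P.real A ^ k := by
  have := hP.1
  have h1 := hP.measureReal_root_snd_inter_allSub hpos hp hA false
  have h2 := hP.measureReal_rootOpen_inter_allSub hpos hp hA
  have h3 := measureReal_inter_add_sdiff (μ := P) (s := allSub A) measurableSet_rootOpen
  have h4 : allSub A \ rootOpen = {ω | (ω []).2 = false} ∩ allSub A := by
    ext ω
    simp [rootOpen, and_comm]
  rw [h4, Set.inter_comm, h1, h2] at h3
  simp only [Bool.false_eq_true, if_false] at h3
  linarith

/-- The edge leading into the root is independent of the root being blue. -/
lemma IsGWPerc.measureReal_rootOpen_inter_blue (hP : IsGWPerc a p P) (hpos : ∀ k, 0 ≤ a k)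
    (htotal : ∑' k, a k = 1) (hp : p ∈ Set.Ico (0 : ℝ) 1) :
    P.real (rootOpen ∩ blue) = p * P.real blue := by
  have := hP.1
  have hA : MeasurableSet (rootOpen ∩ blue)ᶜ :=
    (measurableSet_rootOpen.inter measurableSet_blue).compl
  have h1 := hP.measureReal_rootOpen_inter_allSub hpos hp hA
  have h2 := hP.measureReal_allSub hpos hp hA
  have h3 := hP.measureReal_rootOpen_inter_allSub hpos hp MeasurableSet.univ
  rw [← blue_compl, ← Set.sdiff_eq] at h1
  rw [← blue_compl, probReal_compl_eq_one_sub measurableSet_blue] at h2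
  have h4 := measureReal_inter_add_sdiff (μ := P) (s := rootOpen) measurableSet_blue
  have h5 : allSub Set.univ = Set.univ := by simp [allSub]
  simp only [h5, Set.inter_univ, probReal_univ, one_pow, mul_one, htotal] at h3
  rw [h1, h3, ← h2] at h4
  linarith

lemma IsGWPerc.measureReal_step (hP : IsGWPerc a p P) (hpos : ∀ k, 0 ≤ a k)
    (htotal : ∑' k, a k = 1) (hp : p ∈ Set.Ico (0 : ℝ) 1) {C : Set Cfg}
    (hC : MeasurableSet C) (hbC : blue ⊆ C) :
    P.real (step C) = P.real blue + ∑' k, a k * (P.real C - p * P.real blue) ^ k := by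
  have := hP.1
  have ho := measurableSet_rootOpen.inter measurableSet_blue
  have hset : step C = blue ∪ allSub (C \ (rootOpen ∩ blue)) := by
    rw [Set.sdiff_eq, allSub_inter, ← blue_compl, step, Set.union_inter_distrib_left]
    simp
  have hdisj : Disjoint blue (allSub (C \ (rootOpen ∩ blue))) := by
    rw [Set.sdiff_eq, allSub_inter, ← blue_compl]
    exact disjoint_compl_right.mono_right Set.inter_subset_right
  rw [hset, measureReal_union hdisj (measurableSet_allSub (hC.diff ho)),
    hP.measureReal_allSub hpos hp (hC.diff ho),
    measureReal_sdiff (Set.inter_subset_right.trans hbC) ho,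
    hP.measureReal_rootOpen_inter_blue hpos htotal hp]

end Branching

/-- Consider a branching process whose family-size probability generating
function `G` satisfies `G(0) = 0` and `1 < G'(1) < ∞`, with bond percolation of density
`p ∈ [0,1)` on its family-tree. Let `θ` be the probability that the root is blue and `γ`
the probability that the root is black. Then `γ` is the smallest root in the interval
`[pθ, 1]` of the equation `γ = θ + G(γ - pθ)`. -/
theorem gamma_smallest_root (a : ℕ → ℝ) (hpos : ∀ k, 0 ≤ a k) (hsummable : Summable a)
    (htotal : ∑' k, a k = 1) (hzero : a 0 = 0)
    (hmean_summable : Summable fun k : ℕ => (k : ℝ) * a k)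
    (hmean : 1 < ∑' k : ℕ, (k : ℝ) * a k)
    (G : ℝ → ℝ) (hG : ∀ x, G x = ∑' k, a k * x ^ k)
    (p : ℝ) (hp : p ∈ Set.Ico (0 : ℝ) 1)
    (P : Measure Cfg) (hP : IsGWPerc a p P)
    (θ : ℝ) (hθ : θ = (P {ω | BlueAt ω []}).toReal)
    (γ : ℝ) (hγ : γ = (P {ω | BlackRoot ω}).toReal) :
    IsLeast {x | x ∈ Set.Icc (p * θ) 1 ∧ x = θ + G (x - p * θ)} γ := by
  have := hP.1
  change θ = P.real blue at hθ
  change γ = P.real {ω | BlackRoot ω} at hγ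
  have hθ0 : 0 ≤ θ := hθ ▸ measureReal_nonneg
  have hpθ : p * θ ≤ θ := mul_le_of_le_one_left hθ0 hp.2.le
  have hblue : ∀ n, blue ⊆ blackN n := fun n => blackN_monotone (Nat.zero_le n)
  have hblack : blue ⊆ {ω | BlackRoot ω} := fun ω h => (blackRoot_iff ω).2 (Or.inl h)
  have hmeas : MeasurableSet {ω | BlackRoot ω} := by
    rw [black_eq_iUnion]
    exact MeasurableSet.iUnion measurableSet_blackN
  have hθγ : θ ≤ γ := by
    rw [hθ, hγ]
    exact measureReal_mono hblack
  refine ⟨⟨⟨hpθ.trans hθγ, hγ ▸ measureReal_le_one⟩, ?_⟩, ?_⟩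
  · have h := hP.measureReal_step hpos htotal hp hmeas hblack
    rwa [step_black, ← hγ, ← hθ, ← hG] at h
  · rintro x ⟨⟨hx0, hx1⟩, hx⟩
    have hpθ0 : 0 ≤ p * θ := mul_nonneg hp.1 hθ0
    have hsum : ∀ y : ℝ, 0 ≤ y → y ≤ 1 → Summable fun k => a k * y ^ k := fun y h0 h1 =>
      Summable.of_nonneg_of_le (fun k => mul_nonneg (hpos k) (pow_nonneg h0 k))
        (fun k => mul_le_of_le_one_right (hpos k) (pow_le_one₀ h0 h1)) hsummable
    have hGmono : ∀ y z : ℝ, 0 ≤ y → y ≤ z → z ≤ 1 → G y ≤ G z := fun y z h0 hyz h1 => by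
      rw [hG, hG]
      exact (hsum y h0 (hyz.trans h1)).tsum_le_tsum
        (fun k => mul_le_mul_of_nonneg_left (pow_le_pow_left₀ h0 hyz k) (hpos k))
        (hsum z (h0.trans hyz) h1)
    have hle : ∀ n, P.real (blackN n) ≤ x := by
      intro n
      induction n with
      | zero =>
        have : 0 ≤ G (x - p * θ) := by
          rw [hG]
          exact tsum_nonneg fun k => mul_nonneg (hpos k) (pow_nonneg (by linarith) k)
        change P.real blue ≤ x
        linarith
      | succ n ih =>
        have h := hP.measureReal_step hpos htotal hp (measurableSet_blackN n) (hblue n)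
        have h0 : θ ≤ P.real (blackN n) := by
          rw [hθ]
          exact measureReal_mono (hblue n)
        rw [← hθ, ← hG] at h
        rw [blackN, h, hx]
        have := hGmono (P.real (blackN n) - p * θ) (x - p * θ) (by linarith) (by linarith)
          (by linarith)
        linarith
    have ht := tendsto_measure_iUnion_atTop (μ := P) blackN_monotone
    rw [← black_eq_iUnion] at ht
    have ht' := (ENNReal.tendsto_toReal (measure_ne_top P _)).comp ht
    rw [hγ]
    exact le_of_tendsto' ht' hle

end GW
end

section
/- Let m∈{2,3,…} and p∈[0,1]. For bond percolation with density p on the rooted tree T_m in which every vertex has exactly m children, the probability γ that the root of T_m is black satisfies γ=1 if and only if p ≥ p_b(m), where p_b(m) = (1 − m^{−1/(m−1)})/(1 − m^{−m/(m−1)}). -/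
open MeasureTheory
open scoped ENNReal

namespace TM

/-- Configurations of bond percolation on the rooted tree `T_m` in which every vertex has
exactly `m` children: vertices are words over `Fin m` and the edge `(w, i)` joins the
vertex `w` to its `i`-th child `w ++ [i]`. -/
abbrev Cfg (m : ℕ) := List (Fin m) × Fin m → Bool

/-- The word formed by the first `n` values of the sequence `s`. -/
def prefixSeq {m : ℕ} (s : ℕ → Fin m) (n : ℕ) : List (Fin m) := List.ofFn fun i : Fin n => s i

/-- The vertex `v` is blue: some infinite directed path of `T_m` starting at `v` consists
entirely of open edges. -/
def BlueAt {m : ℕ} (ω : Cfg m) (v : List (Fin m)) : Prop :=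
  ∃ s : ℕ → Fin m, ∀ n : ℕ, ω (v ++ prefixSeq s n, s n) = true

/-- The root is black: every infinite directed path of `T_m` starting at the root contains
a blue vertex. -/
def BlackRoot {m : ℕ} (ω : Cfg m) : Prop :=
  ∀ s : ℕ → Fin m, ∃ n, BlueAt ω (prefixSeq s n)

/-- `P` is the law of bond percolation on `T_m` with density `p`: the edge states are
i.i.d. Bernoulli(`p`). -/
def IsBernoulliPerc {m : ℕ} (p : ℝ) (P : Measure (Cfg m)) : Prop :=
  IsProbabilityMeasure P ∧
    ∀ (t : Finset (List (Fin m) × Fin m)) (g : Cfg m),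
      P {ω | ∀ e ∈ t, ω e = g e} = ∏ e ∈ t, ENNReal.ofReal (if g e then p else 1 - p)

/-- The critical value `m ^ (-1 / (m - 1))` of the probability that an edge of `T_m` does not
lead to a blue child through an open edge. -/
noncomputable def critPt (m : ℕ) : ℝ := (m : ℝ) ^ (-(1 : ℝ) / ((m : ℝ) - 1))

lemma critPt_pos {m : ℕ} (hm : 2 ≤ m) : 0 < critPt m := by
  have : (0 : ℝ) < m := by positivity
  exact Real.rpow_pos_of_pos this _

lemma critPt_lt_one {m : ℕ} (hm : 2 ≤ m) : critPt m < 1 := by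
  have h : (2 : ℝ) ≤ m := by exact_mod_cast hm
  refine Real.rpow_lt_one_of_one_lt_of_neg (by linarith) ?_
  exact div_neg_of_neg_of_pos (by norm_num) (by linarith)

lemma critPt_pow (m : ℕ) :
    critPt m ^ m = (m : ℝ) ^ (-(m : ℝ) / ((m : ℝ) - 1)) := by
  rw [critPt, ← Real.rpow_natCast, ← Real.rpow_mul (Nat.cast_nonneg m)]
  congr 1
  ring

lemma mul_critPt_pow {m : ℕ} (hm : 2 ≤ m) : m * critPt m ^ (m - 1) = 1 := by
  have h : (2 : ℝ) ≤ m := by exact_mod_cast hm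
  rw [critPt, ← Real.rpow_natCast, ← Real.rpow_mul (Nat.cast_nonneg m), Nat.cast_sub (by omega),
    Nat.cast_one, div_mul_cancel₀ _ (by linarith), Real.rpow_neg_one,
    mul_inv_cancel₀ (by linarith)]

lemma eq_one_of_fixedPoint {m : ℕ} (hm : 2 ≤ m) {β γ p y : ℝ} (hy : y = 1 - p * β)
    (hβ : 1 - β = y ^ m) (hγ : γ = β + (γ - p * β) ^ m) (hγ1 : γ ≤ 1) (hpγ : p * β ≤ γ)
    (hcrit : m * y ^ (m - 1) ≤ 1) : γ = 1 := by
  by_contra hne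
  have hlt : γ < 1 := lt_of_le_of_ne hγ1 hne
  set z := γ - p * β with hz
  have hz0 : 0 ≤ z := by linarith
  have hzy : z < y := by linarith
  have key := (Commute.all y z).geom_sum₂_mul m
  have hsum : ∑ i ∈ Finset.range m, y ^ i * z ^ (m - 1 - i)
      < ∑ i ∈ Finset.range m, y ^ (m - 1) := by
    have hterm : ∀ i ∈ Finset.range m, y ^ (m - 1) = y ^ i * y ^ (m - 1 - i) := by
      intro i hi
      rw [Finset.mem_range] at hi
      rw [← pow_add]
      congr 1
      omega
    refine Finset.sum_lt_sum (fun i hi => ?_) ⟨0, by simp; omega, ?_⟩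
    · rw [hterm i hi]
      have : 0 ≤ y := by linarith
      gcongr
    · simpa using pow_lt_pow_left₀ hzy hz0 (by omega)
  rw [Finset.sum_const, Finset.card_range, nsmul_eq_mul] at hsum
  have : y - z = 1 - γ := by linarith
  have h2 : y ^ m - z ^ m = 1 - γ := by linarith
  rw [this, h2] at key
  have : (∑ i ∈ Finset.range m, y ^ i * z ^ (m - 1 - i) - 1) * (1 - γ) = 0 := by linarith
  rcases mul_eq_zero.1 this with h | h <;> linarith

lemma exists_superFixedPoint {m : ℕ} {β p y : ℝ} (hy : y = 1 - p * β)
    (hβ : 1 - β = y ^ m) (hβ1 : β < 1) (hcrit : 1 < m * y ^ (m - 1)) :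
    ∃ x, β ≤ x ∧ x < 1 ∧ β + (x - p * β) ^ m ≤ x := by
  have hcont : Continuous fun x : ℝ =>
      ∑ i ∈ Finset.range m, y ^ i * (x - p * β) ^ (m - 1 - i) := by fun_prop
  have hone : ∑ i ∈ Finset.range m, y ^ i * (1 - p * β) ^ (m - 1 - i) = m * y ^ (m - 1) := by
    rw [← hy]
    rw [Finset.sum_congr rfl (g := fun _ => y ^ (m - 1)), Finset.sum_const, Finset.card_range,
      nsmul_eq_mul]
    intro i hi
    rw [Finset.mem_range] at hi
    rw [← pow_add]
    congr 1
    omega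
  have hev := (hcont.tendsto 1).eventually_const_lt (hone ▸ hcrit)
  obtain ⟨x, hx, hxβ, hx1⟩ := ((hev.filter_mono nhdsWithin_le_nhds).and
    (Ioo_mem_nhdsLT hβ1)).exists
  refine ⟨x, hxβ.le, hx1, ?_⟩
  have key := (Commute.all y (x - p * β)).geom_sum₂_mul m
  have : y - (x - p * β) = 1 - x := by linarith
  rw [this] at key
  nlinarith

lemma critPt_lt_of_lt {m : ℕ} (hm : 2 ≤ m) {β p y : ℝ} (hp : 0 ≤ p) (hy : y = 1 - p * β)
    (hy0 : 0 ≤ y) (hβ : 1 - β = y ^ m)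
    (hlt : p * (1 - critPt m ^ m) < 1 - critPt m) : critPt m < y := by
  by_contra! hle
  have hy1 : y < 1 := hle.trans_lt (critPt_lt_one hm)
  have h1 := geom_sum_mul_neg y m
  have h2 := geom_sum_mul_neg (critPt m) m
  have hmono : ∑ i ∈ Finset.range m, y ^ i ≤ ∑ i ∈ Finset.range m, critPt m ^ i := by
    gcongr
  have h3 : (p * ∑ i ∈ Finset.range m, y ^ i) * (1 - y) = 1 * (1 - y) := by
    rw [mul_assoc, h1, ← hβ, hy]
    ring
  have h4 := mul_right_cancel₀ (by linarith) h3
  rw [← h2, ← mul_assoc] at hlt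
  have h5 : p * ∑ i ∈ Finset.range m, critPt m ^ i < 1 := by
    refine lt_of_mul_lt_mul_right (a := 1 - critPt m) (by linarith) ?_
    linarith [critPt_lt_one hm]
  nlinarith

lemma pow_lt_self_critPt {m : ℕ} (hm : 2 ≤ m) : critPt m ^ m < critPt m := by
  simpa using pow_lt_pow_right_of_lt_one₀ (critPt_pos hm) (critPt_lt_one hm) (by omega : 1 < m)

/-- The configuration in the subtree hanging from the vertex `v`. -/
def shift {m : ℕ} (v : List (Fin m)) (ω : Cfg m) : Cfg m := fun e => ω (v ++ e.1, e.2)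

@[simp] lemma shift_nil {m : ℕ} (ω : Cfg m) : shift [] ω = ω := rfl

lemma shift_append {m : ℕ} (v w : List (Fin m)) (ω : Cfg m) :
    shift (v ++ w) ω = shift w (shift v ω) := by
  funext e
  simp [shift]

lemma measurable_shift {m : ℕ} (v : List (Fin m)) : Measurable (shift v) := by
  unfold shift
  fun_prop

lemma prefixSeq_zero {m : ℕ} (s : ℕ → Fin m) : prefixSeq s 0 = [] := by simp [prefixSeq]

lemma prefixSeq_succ {m : ℕ} (s : ℕ → Fin m) (n : ℕ) :
    prefixSeq s (n + 1) = prefixSeq s n ++ [s n] := by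
  rw [prefixSeq, List.ofFn_succ_last]
  rfl

lemma prefixSeq_succ' {m : ℕ} (s : ℕ → Fin m) (n : ℕ) :
    prefixSeq s (n + 1) = [s 0] ++ prefixSeq (fun k => s (k + 1)) n := by
  simp [prefixSeq, List.ofFn_succ]

lemma exists_forall_of_antitone {ι : Type*} [Finite ι] {Q : ι → ℕ → Prop}
    (hQ : ∀ i n, Q i (n + 1) → Q i n) (h : ∀ n, ∃ i, Q i n) : ∃ i, ∀ n, Q i n := by
  by_contra! hne
  have := Fintype.ofFinite ι
  choose N hN using hne
  obtain ⟨i, hi⟩ := h (Finset.univ.sup N)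
  exact hN i (antitone_nat_of_succ_le (f := Q i) (hQ i) (Finset.le_sup (Finset.mem_univ i)) hi)

lemma exists_seq_of_step {m : ℕ} {S : Cfg m → Prop} {R : Fin m → Cfg m → Prop}
    (hstep : ∀ ω, S ω → ∃ i, R i ω ∧ S (shift [i] ω)) {ω : Cfg m} (hω : S ω) :
    ∃ s : ℕ → Fin m, ∀ n, S (shift (prefixSeq s n) ω) ∧ R (s n) (shift (prefixSeq s n) ω) := by
  choose c hcR hcS using hstep
  let st : ℕ → {η : Cfg m // S η} := fun n =>
    Nat.rec ⟨ω, hω⟩ (fun _ η => ⟨shift [c η.1 η.2] η.1, hcS η.1 η.2⟩) n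
  let s : ℕ → Fin m := fun n => c (st n).1 (st n).2
  have hst : ∀ n, (st n).1 = shift (prefixSeq s n) ω := by
    intro n
    induction n with
    | zero => simp [prefixSeq_zero, st]
    | succ n ih =>
      rw [prefixSeq_succ, shift_append, ← ih]
  refine ⟨s, fun n => ?_⟩
  rw [← hst]
  exact ⟨(st n).2, hcR _ _⟩

/-- There is an open directed path of length `n` starting at the root. -/
def OpenTo {m : ℕ} : ℕ → Cfg m → Prop
  | 0, _ => True
  | n + 1, ω => ∃ i, ω ([], i) = true ∧ OpenTo n (shift [i] ω)

lemma OpenTo.of_succ {m : ℕ} (n : ℕ) : ∀ ω : Cfg m, OpenTo (n + 1) ω → OpenTo n ω := by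
  induction n with
  | zero => exact fun _ _ => trivial
  | succ n ih => exact fun ω ⟨i, hi, h⟩ => ⟨i, hi, ih _ h⟩

/-- The root is blue. -/
def Blue {m : ℕ} (ω : Cfg m) : Prop := BlueAt ω []

lemma blueAt_iff {m : ℕ} (ω : Cfg m) (v : List (Fin m)) : BlueAt ω v ↔ Blue (shift v ω) := by
  simp [Blue, BlueAt, shift]

lemma blue_iff_exists {m : ℕ} (ω : Cfg m) :
    Blue ω ↔ ∃ i, ω ([], i) = true ∧ Blue (shift [i] ω) := by
  constructor
  · rintro ⟨s, hs⟩
    refine ⟨s 0, by simpa [prefixSeq_zero] using hs 0, fun k => s (k + 1), fun n => ?_⟩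
    simpa [prefixSeq_succ', shift] using hs (n + 1)
  · rintro ⟨i, hi, s, hs⟩
    refine ⟨fun n => Nat.casesOn n i s, fun n => ?_⟩
    cases n with
    | zero => simpa [prefixSeq_zero] using hi
    | succ n => simpa [prefixSeq_succ', shift] using hs n

lemma blue_iff_forall_openTo {m : ℕ} (ω : Cfg m) : Blue ω ↔ ∀ n, OpenTo n ω := by
  constructor
  · intro h n
    induction n generalizing ω with
    | zero => trivial
    | succ n ih =>
      obtain ⟨i, hi, hb⟩ := (blue_iff_exists ω).1 h
      exact ⟨i, hi, ih _ hb⟩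
  · intro h
    have hstep : ∀ η : Cfg m, (∀ n, OpenTo n η) →
        ∃ i, η ([], i) = true ∧ ∀ n, OpenTo n (shift [i] η) := by
      intro η hη
      obtain ⟨i, hi⟩ := exists_forall_of_antitone
        (Q := fun i n => η ([], i) = true ∧ OpenTo n (shift [i] η))
        (fun i n hq => ⟨hq.1, OpenTo.of_succ n _ hq.2⟩) (fun n => hη (n + 1))
      exact ⟨i, (hi 0).1, fun n => (hi n).2⟩
    obtain ⟨s, hs⟩ := exists_seq_of_step (S := fun η => ∀ n, OpenTo n η)
      (R := fun i η => η ([], i) = true) hstep h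
    exact ⟨s, fun n => by simpa [shift] using (hs n).2⟩

/-- Every directed path from the root meets a blue vertex within its first `n` steps. -/
def BlackBy {m : ℕ} : ℕ → Cfg m → Prop
  | 0, ω => Blue ω
  | n + 1, ω => Blue ω ∨ ∀ i, BlackBy n (shift [i] ω)

lemma BlackBy.of_blue {m : ℕ} {n : ℕ} {ω : Cfg m} (h : Blue ω) : BlackBy n ω := by
  cases n with
  | zero => exact h
  | succ n => exact Or.inl h

lemma BlackBy.succ {m : ℕ} (n : ℕ) : ∀ ω : Cfg m, BlackBy n ω → BlackBy (n + 1) ω := by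
  induction n with
  | zero => exact fun _ h => Or.inl h
  | succ n ih => exact fun ω h => h.imp_right fun h i => ih _ (h i)

lemma blackRoot_iff_exists {m : ℕ} (ω : Cfg m) : BlackRoot ω ↔ ∃ n, BlackBy n ω := by
  constructor
  · intro h
    by_contra! hne
    have hstep : ∀ η : Cfg m, (∀ n, ¬ BlackBy n η) →
        ∃ i : Fin m, True ∧ ∀ n, ¬ BlackBy n (shift [i] η) := by
      intro η hη
      obtain ⟨i, hi⟩ := exists_forall_of_antitone
        (Q := fun i n => ¬ BlackBy n (shift [i] η))
        (fun i n hq h => hq (BlackBy.succ n _ h))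
        (fun n => by
          by_contra! hall
          exact hη (n + 1) (Or.inr hall))
      exact ⟨i, trivial, hi⟩
    obtain ⟨s, hs⟩ := exists_seq_of_step (S := fun η => ∀ n, ¬ BlackBy n η)
      (R := fun _ _ => True) hstep hne
    obtain ⟨n, hn⟩ := h s
    exact (hs n).1 0 ((blueAt_iff ω _).1 hn)
  · rintro ⟨n, hn⟩ s
    induction n generalizing ω s with
    | zero => exact ⟨0, hn⟩
    | succ n ih =>
      rcases hn with h | h
      · exact ⟨0, h⟩
      · obtain ⟨k, hk⟩ := ih _ (h (s 0)) fun k => s (k + 1)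
        refine ⟨k + 1, ?_⟩
        rw [blueAt_iff] at hk ⊢
        rwa [prefixSeq_succ', shift_append]

lemma measurableSet_openTo {m : ℕ} (n : ℕ) : MeasurableSet {ω : Cfg m | OpenTo n ω} := by
  induction n with
  | zero => exact MeasurableSet.univ
  | succ n ih =>
    have : {ω : Cfg m | OpenTo (n + 1) ω} =
        ⋃ i, (fun ω : Cfg m => ω ([], i)) ⁻¹' {true} ∩ shift [i] ⁻¹' {ω | OpenTo n ω} := by
      ext ω
      simp [OpenTo]
    rw [this]
    exact .iUnion fun i => (measurable_pi_apply _ (measurableSet_singleton _)).inter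
      (measurable_shift _ ih)

lemma measurableSet_blue {m : ℕ} : MeasurableSet {ω : Cfg m | Blue ω} := by
  simp only [blue_iff_forall_openTo, Set.ofPred_forall]
  exact .iInter measurableSet_openTo

lemma measurableSet_blackBy {m : ℕ} (n : ℕ) : MeasurableSet {ω : Cfg m | BlackBy n ω} := by
  induction n with
  | zero => exact measurableSet_blue
  | succ n ih =>
    have : {ω : Cfg m | BlackBy (n + 1) ω} =
        {ω | Blue ω} ∪ ⋂ i, shift [i] ⁻¹' {ω | BlackBy n ω} := by
      ext ω
      simp [BlackBy]
    rw [this]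
    exact measurableSet_blue.union (.iInter fun i => measurable_shift _ ih)

/-- The law of a single edge. -/
noncomputable def edgeLaw (p : ℝ) : Measure Bool :=
  ENNReal.ofReal p • Measure.dirac true + ENNReal.ofReal (1 - p) • Measure.dirac false

lemma edgeLaw_singleton (p : ℝ) (b : Bool) :
    edgeLaw p {b} = ENNReal.ofReal (if b then p else 1 - p) := by
  cases b <;> simp [edgeLaw]

lemma isProbabilityMeasure_edgeLaw {p : ℝ} (hp : p ∈ Set.Icc (0 : ℝ) 1) :
    IsProbabilityMeasure (edgeLaw p) := by
  constructor
  have : ENNReal.ofReal p + ENNReal.ofReal (1 - p) = 1 := by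
    rw [← ENNReal.ofReal_add hp.1 (by linarith [hp.2])]
    simp
  simpa [edgeLaw] using this

lemma IsBernoulliPerc.eq_infinitePi {m : ℕ} {p : ℝ} {P : Measure (Cfg m)}
    [IsProbabilityMeasure (edgeLaw p)] (hP : IsBernoulliPerc p P) :
    P = Measure.infinitePi fun _ => edgeLaw p := by
  classical
  have := hP.1
  refine ((Measure.isProjectiveLimit_infinitePi _).unique ?_).symm
  intro I
  refine Measure.ext_of_singleton fun x => ?_
  let g : Cfg m := fun e => if h : e ∈ I then x ⟨e, h⟩ else true
  rw [Measure.map_apply (by fun_prop) (measurableSet_singleton x), Measure.pi_singleton]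
  have hset : I.restrict (π := fun _ => Bool) ⁻¹' {x} = {ω : Cfg m | ∀ e ∈ I, ω e = g e} := by
    ext ω
    simp only [Set.mem_preimage, Set.mem_singleton_iff, funext_iff, Subtype.forall,
      Finset.restrict, Set.mem_ofPred_eq]
    refine forall₂_congr fun e he => ?_
    simp [g, he]
  rw [hset, hP.2 I g, ← Finset.prod_coe_sort]
  refine Finset.prod_congr rfl fun e _ => ?_
  rw [edgeLaw_singleton]
  simp [g]

/-- Labels of the edges in one branch of the tree: `true` is the edge at the root and `false`
labels the edges of the subtree below it. -/
abbrev BranchIdx (m : ℕ) : Bool → Type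
  | true => Unit
  | false => List (Fin m) × Fin m

/-- The edge of the tree with a given label in the `i`-th branch. -/
def branchEdge {m : ℕ} : Fin m × (Σ b, BranchIdx m b) → List (Fin m) × Fin m
  | (i, ⟨true, _⟩) => ([], i)
  | (i, ⟨false, e⟩) => (i :: e.1, e.2)

lemma branchEdge_injective {m : ℕ} : Function.Injective (branchEdge (m := m)) := by
  rintro ⟨i, ⟨_ | _, x⟩⟩ ⟨j, ⟨_ | _, y⟩⟩ h
  · obtain ⟨x1, x2⟩ := x
    obtain ⟨y1, y2⟩ := y
    simp_all [branchEdge]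
  · simp [branchEdge] at h
  · simp [branchEdge] at h
  · simp_all [branchEdge]

lemma IsBernoulliPerc.measure_forall_branch {m : ℕ} {p : ℝ} {P : Measure (Cfg m)}
    [IsProbabilityMeasure (edgeLaw p)] (hP : IsBernoulliPerc p P)
    {T : Set ((Σ b, BranchIdx m b) → Bool)} (hT : MeasurableSet T) :
    P {ω | ∀ i, (fun x => ω (branchEdge (i, x))) ∈ T} =
      (Measure.infinitePi fun _ : Σ b, BranchIdx m b => edgeLaw p) T ^ m := by
  have h1 := Measure.map_infinitePi_infinitePi_of_inj
    (P := fun _ : List (Fin m) × Fin m => edgeLaw p) (branchEdge_injective (m := m))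
  have h2 := Measure.infinitePi_map_curry
    (fun (_ : Fin m) (_ : Σ b, BranchIdx m b) => edgeLaw p)
  rw [← h1, Measure.map_map (by fun_prop) (by fun_prop), ← hP.eq_infinitePi] at h2
  have hbox := Measure.infinitePi_pi
    (fun _ : Fin m => Measure.infinitePi fun _ : Σ b, BranchIdx m b => edgeLaw p)
    (s := Finset.univ) (t := fun _ => T) (fun _ _ => hT)
  rw [← h2, Measure.map_apply (by fun_prop)
    (.pi (Finset.countable_toSet _) fun _ _ => hT)] at hbox
  rw [Finset.prod_const, Finset.card_univ, Fintype.card_fin] at hbox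
  rw [← hbox]
  congr 1
  ext ω
  simp only [Set.mem_preimage, Set.mem_pi, Finset.coe_univ, Set.mem_univ, forall_const]
  rfl

lemma measure_branch {m : ℕ} {p : ℝ} [IsProbabilityMeasure (edgeLaw p)]
    {B : Set Bool} {A : Set (Cfg m)} (hA : MeasurableSet A) :
    (Measure.infinitePi fun _ : Σ b, BranchIdx m b => edgeLaw p)
        {x | x ⟨true, ()⟩ ∈ B ∧ (fun e => x ⟨false, e⟩) ∈ A} =
      edgeLaw p B * (Measure.infinitePi fun _ => edgeLaw p) A := by
  have h := Measure.infinitePi_map_piCurry (fun (b : Bool) (_ : BranchIdx m b) => edgeLaw p)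
  let t : (b : Bool) → Set (BranchIdx m b → Bool) := fun b => match b with
    | true => {f | f () ∈ B}
    | false => A
  have ht : ∀ b, MeasurableSet (t b) := by
    rintro (_ | _)
    · exact hA
    · exact measurable_pi_apply (X := fun _ : Unit => Bool) () (MeasurableSet.of_discrete (s := B))
  have hbox := Measure.infinitePi_pi
    (fun b : Bool => Measure.infinitePi fun _ : BranchIdx m b => edgeLaw p)
    (s := Finset.univ) (t := t) (fun b _ => ht b)
  rw [← h, Measure.map_apply (by fun_prop)
    (.pi (Finset.countable_toSet _) fun b _ => ht b)] at hbox
  have hB : (Measure.infinitePi fun _ : Unit => edgeLaw p) {f | f () ∈ B} = edgeLaw p B := by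
    have h := Measure.infinitePi_map_eval (fun _ : Unit => edgeLaw p) ()
    apply_fun (· B) at h
    rwa [Measure.map_apply (by fun_prop) MeasurableSet.of_discrete] at h
  rw [Fintype.prod_bool] at hbox
  rw [← hB]
  refine Eq.trans ?_ hbox
  congr 1
  ext x
  simp only [Set.mem_preimage, Set.mem_pi, Finset.coe_univ, Set.mem_univ, forall_const,
    Bool.forall_bool]
  exact and_comm

lemma IsBernoulliPerc.measureReal_forall_child {m : ℕ} {p : ℝ} (hp : p ∈ Set.Icc (0 : ℝ) 1)
    {P : Measure (Cfg m)} (hP : IsBernoulliPerc p P) {A C : Set (Cfg m)}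
    (hA : MeasurableSet A) (hC : MeasurableSet C) (hAC : A ⊆ C) :
    P.real {ω | ∀ i, shift [i] ω ∈ C ∧ ¬ (ω ([], i) = true ∧ shift [i] ω ∈ A)} =
      (P.real C - p * P.real A) ^ m := by
  have := isProbabilityMeasure_edgeLaw hp
  let Q := Measure.infinitePi fun _ : Σ b, BranchIdx m b => edgeLaw p
  let rest : ((Σ b, BranchIdx m b) → Bool) → Cfg m := fun x e => x ⟨false, e⟩
  have hrest : Measurable rest := by fun_prop
  have hopen : MeasurableSet {x : (Σ b, BranchIdx m b) → Bool | x ⟨true, ()⟩ = true} :=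
    measurable_pi_apply (X := fun _ : Σ b, BranchIdx m b => Bool) ⟨true, ()⟩
      (measurableSet_singleton true)
  have hD : MeasurableSet {x | x ⟨true, ()⟩ = true ∧ rest x ∈ A} := hopen.inter (hrest hA)
  have hQC : Q.real (rest ⁻¹' C) = P.real C := by
    have h := measure_branch (p := p) (B := Set.univ) hC
    rw [measure_univ, one_mul, ← hP.eq_infinitePi] at h
    rw [measureReal_def, measureReal_def, ← h]
    simp [Q, rest, Set.preimage]
  have hQA : Q.real {x | x ⟨true, ()⟩ = true ∧ rest x ∈ A} = p * P.real A := by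
    have h := measure_branch (p := p) (B := {true}) hA
    rw [edgeLaw_singleton, ← hP.eq_infinitePi] at h
    simp only [Set.mem_singleton_iff, if_true] at h
    rw [measureReal_def, measureReal_def, h, ENNReal.toReal_mul, ENNReal.toReal_ofReal hp.1]
  have hsub : {x | x ⟨true, ()⟩ = true ∧ rest x ∈ A} ⊆ rest ⁻¹' C := fun x hx => hAC hx.2
  have h := hP.measure_forall_branch ((hrest hC).diff hD)
  rw [← hQC, ← hQA, ← measureReal_sdiff hsub hD, measureReal_def, measureReal_def,
    ← ENNReal.toReal_pow, ← h]
  rfl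

lemma IsBernoulliPerc.measureReal_blue {m : ℕ} {p : ℝ} (hp : p ∈ Set.Icc (0 : ℝ) 1)
    {P : Measure (Cfg m)} (hP : IsBernoulliPerc p P) :
    1 - P.real {ω | Blue ω} = (1 - p * P.real {ω | Blue ω}) ^ m := by
  have := hP.1
  have h := hP.measureReal_forall_child hp measurableSet_blue .univ (Set.subset_univ _)
  rw [probReal_univ] at h
  rw [← h, ← probReal_compl_eq_one_sub measurableSet_blue]
  congr 1
  ext ω
  simp [blue_iff_exists ω]

lemma IsBernoulliPerc.measureReal_openTo_succ {m : ℕ} {p : ℝ} (hp : p ∈ Set.Icc (0 : ℝ) 1)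
    {P : Measure (Cfg m)} (hP : IsBernoulliPerc p P) (n : ℕ) :
    1 - P.real {ω | OpenTo (n + 1) ω} = (1 - p * P.real {ω | OpenTo n ω}) ^ m := by
  have := hP.1
  have h := hP.measureReal_forall_child hp (measurableSet_openTo n) .univ (Set.subset_univ _)
  rw [probReal_univ] at h
  rw [← h, ← probReal_compl_eq_one_sub (measurableSet_openTo _)]
  congr 1
  ext ω
  simp [OpenTo]

lemma IsBernoulliPerc.measureReal_blackBy_succ {m : ℕ} {p : ℝ} (hp : p ∈ Set.Icc (0 : ℝ) 1)
    {P : Measure (Cfg m)} (hP : IsBernoulliPerc p P) (n : ℕ) :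
    P.real {ω | BlackBy (n + 1) ω} = P.real {ω | Blue ω} +
      (P.real {ω | BlackBy n ω} - p * P.real {ω | Blue ω}) ^ m := by
  have := hP.1
  have h := hP.measureReal_forall_child hp measurableSet_blue (measurableSet_blackBy n)
    fun _ => BlackBy.of_blue
  rw [← h, ← measureReal_sdiff_add_inter (s := {ω | BlackBy (n + 1) ω}) measurableSet_blue,
    add_comm]
  congr 2
  · ext ω
    simpa using BlackBy.of_blue
  · ext ω
    have := blue_iff_exists ω
    simp only [BlackBy, Set.mem_sdiff, Set.mem_ofPred_eq]
    rw [this]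
    push Not
    grind

lemma tendsto_measureReal_openTo {m : ℕ} (P : Measure (Cfg m)) [IsProbabilityMeasure P] :
    Filter.Tendsto (fun n => P.real {ω | OpenTo n ω}) Filter.atTop
      (nhds (P.real {ω | Blue ω})) := by
  have h := tendsto_measure_iInter_atTop (μ := P) (s := fun n => {ω : Cfg m | OpenTo n ω})
    (fun n => (measurableSet_openTo n).nullMeasurableSet)
    (antitone_nat_of_succ_le fun n => OpenTo.of_succ n) ⟨0, measure_ne_top _ _⟩
  have hset : ⋂ n, {ω : Cfg m | OpenTo n ω} = {ω | Blue ω} := by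
    ext ω
    simp [blue_iff_forall_openTo]
  rw [hset] at h
  exact (ENNReal.tendsto_toReal (measure_ne_top _ _)).comp h

lemma tendsto_measureReal_blackBy {m : ℕ} (P : Measure (Cfg m)) [IsProbabilityMeasure P] :
    Filter.Tendsto (fun n => P.real {ω | BlackBy n ω}) Filter.atTop
      (nhds (P.real {ω | BlackRoot ω})) := by
  have h := tendsto_measure_iUnion_atTop (μ := P) (s := fun n => {ω : Cfg m | BlackBy n ω})
    (monotone_nat_of_le_succ fun n => BlackBy.succ n)
  have hset : ⋃ n, {ω : Cfg m | BlackBy n ω} = {ω | BlackRoot ω} := by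
    ext ω
    simp [blackRoot_iff_exists]
  rw [hset] at h
  exact (ENNReal.tendsto_toReal (measure_ne_top _ _)).comp h

lemma IsBernoulliPerc.le_measureReal_blue {m : ℕ} {p : ℝ} (hp : p ∈ Set.Icc (0 : ℝ) 1)
    {P : Measure (Cfg m)} (hP : IsBernoulliPerc p P) {ε : ℝ} (hε1 : ε ≤ 1)
    (hε : (1 - p * ε) ^ m ≤ 1 - ε) : ε ≤ P.real {ω | Blue ω} := by
  have := hP.1
  refine ge_of_tendsto' (tendsto_measureReal_openTo P) fun n => ?_
  induction n with
  | zero => simpa [OpenTo] using hε1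
  | succ n ih =>
    have h := hP.measureReal_openTo_succ hp n
    have h1 : P.real {ω | OpenTo n ω} ≤ 1 := measureReal_le_one
    have : (1 - p * P.real {ω | OpenTo n ω}) ^ m ≤ (1 - p * ε) ^ m := by
      have h0 : p * P.real {ω | OpenTo n ω} ≤ 1 := mul_le_one₀ hp.2 measureReal_nonneg h1
      have := hp.1
      gcongr
    linarith

lemma IsBernoulliPerc.measureReal_blackRoot_le {m : ℕ} {p : ℝ} (hp : p ∈ Set.Icc (0 : ℝ) 1)
    {P : Measure (Cfg m)} (hP : IsBernoulliPerc p P) {x : ℝ} (hx : P.real {ω | Blue ω} ≤ x)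
    (hfix : P.real {ω | Blue ω} + (x - p * P.real {ω | Blue ω}) ^ m ≤ x) :
    P.real {ω | BlackRoot ω} ≤ x := by
  have := hP.1
  refine le_of_tendsto' (tendsto_measureReal_blackBy P) fun n => ?_
  induction n with
  | zero => exact hx
  | succ n ih =>
    rw [hP.measureReal_blackBy_succ hp n]
    refine le_trans ?_ hfix
    have h1 : P.real {ω | Blue ω} ≤ P.real {ω | BlackBy n ω} :=
      measureReal_mono fun _ => BlackBy.of_blue
    have h2 : p * P.real {ω | Blue ω} ≤ P.real {ω | Blue ω} :=
      mul_le_of_le_one_left measureReal_nonneg hp.2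
    gcongr
    linarith

lemma IsBernoulliPerc.measureReal_blackRoot {m : ℕ} {p : ℝ} (hp : p ∈ Set.Icc (0 : ℝ) 1)
    {P : Measure (Cfg m)} (hP : IsBernoulliPerc p P) :
    P.real {ω | BlackRoot ω} = P.real {ω | Blue ω} +
      (P.real {ω | BlackRoot ω} - p * P.real {ω | Blue ω}) ^ m := by
  have := hP.1
  have h := tendsto_measureReal_blackBy P
  have h' := (Filter.tendsto_add_atTop_iff_nat 1).2 h
  simp only [hP.measureReal_blackBy_succ hp] at h'
  exact tendsto_nhds_unique h' (((h.sub_const _).pow m).const_add _)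

/-- Let `m ≥ 2` and `p ∈ [0,1]`. For bond percolation with density `p` on
the rooted tree `T_m` in which every vertex has exactly `m` children, the probability `γ`
that the root is black satisfies `γ = 1` if and only if `p ≥ p_b(m)`, where
`p_b(m) = (1 - m^{-1/(m-1)}) / (1 - m^{-m/(m-1)})`. -/
theorem root_black_iff (m : ℕ) (hm : 2 ≤ m) (p : ℝ) (hp : p ∈ Set.Icc (0 : ℝ) 1)
    (P : Measure (Cfg m)) (hP : IsBernoulliPerc p P) :
    P {ω | BlackRoot ω} = 1 ↔
      (1 - (m : ℝ) ^ (-(1 : ℝ) / ((m : ℝ) - 1))) /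
          (1 - (m : ℝ) ^ (-(m : ℝ) / ((m : ℝ) - 1))) ≤ p := by
  have := hP.1
  have hc0 := critPt_pos hm
  have hc1 := critPt_lt_one hm
  have hcm := mul_critPt_pow hm
  have hcm1 : critPt m ^ m < 1 := (pow_lt_self_critPt hm).trans hc1
  rw [← critPt_pow, ← critPt, div_le_iff₀ (by linarith)]
  have hone : P {ω | BlackRoot ω} = 1 ↔ P.real {ω | BlackRoot ω} = 1 := by
    rw [measureReal_def, ENNReal.toReal_eq_one_iff]
  rw [hone]
  have hβ := hP.measureReal_blue hp
  have hγ := hP.measureReal_blackRoot hp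
  have hγ1 : P.real {ω | BlackRoot ω} ≤ 1 := measureReal_le_one
  have hβ0 : 0 ≤ P.real {ω | Blue ω} := measureReal_nonneg
  have hβγ : P.real {ω | Blue ω} ≤ P.real {ω | BlackRoot ω} :=
    measureReal_mono fun ω hω => (blackRoot_iff_exists ω).2 ⟨0, hω⟩
  have hle := @IsBernoulliPerc.measureReal_blackRoot_le m p hp P hP
  have hge := @IsBernoulliPerc.le_measureReal_blue m p hp P hP
  generalize P.real {ω | Blue ω} = β at *
  generalize P.real {ω | BlackRoot ω} = γ at *
  have hpβ : p * β ≤ β := mul_le_of_le_one_left hβ0 hp.2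
  constructor
  · intro h1
    by_contra! hlt
    have hy0 : 0 ≤ 1 - p * β := by linarith
    have hcy := critPt_lt_of_lt hm hp.1 rfl hy0 hβ hlt
    have hcrit : 1 < m * (1 - p * β) ^ (m - 1) := by
      refine hcm.symm.trans_lt ?_
      have : (0 : ℝ) < m := by positivity
      gcongr
      omega
    have hβ1 : β < 1 := by
      have := pow_pos (hc0.trans hcy) m
      linarith
    obtain ⟨x, hβx, hx1, hx⟩ := exists_superFixedPoint rfl hβ hβ1 hcrit
    linarith [hle hβx hx]
  · intro h
    have hε := hge (ε := 1 - critPt m ^ m) (by linarith [pow_pos hc0 m]) (by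
      have : p * (1 - critPt m ^ m) ≤ 1 := mul_le_one₀ hp.2 (by linarith)
        (by linarith [pow_pos hc0 m])
      rw [sub_sub_cancel]
      gcongr
      linarith)
    have hy : 1 - p * β ≤ critPt m := by
      have := mul_le_mul_of_nonneg_left hε hp.1
      linarith
    refine eq_one_of_fixedPoint hm rfl hβ hγ hγ1 (hpβ.trans hβγ) ?_
    refine le_trans ?_ hcm.le
    gcongr
    linarith

end TM
end
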